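/- Let f₀ : ℝ → ℝ be continuously differentiable with f₀(v) → 0 as v → ±∞, set φ = f₀′, assume φ integrable with bounded derivative, and suppose there are a < c < b with φ > 0 on (−∞,a) ∪ (c,b), φ < 0 on (a,c) ∪ (b,∞), f₀(a) = f₀(b) = M > 0 and f₀(c) = 0. Fix k ≠ 0 and ξ, η ∈ (0,M); put a_< = sup{ v < a : f₀(v) ≤ ξ }, a_> = inf{ v > a : f₀(v) ≤ ξ }, b_< = sup{ v < b : f₀(v) ≤ η }, b_> = inf{ v > b : f₀(v) ≤ η }. If ( (a_> − a_<)·ξ ) / ( (c − a_>)(c − a_<) ) + ( (b_> − b_<)·η ) / ( (b_< − c)(b_> − c) ) > k², then there exists exactly one λ ∈ ℂ with Re λ > 0 and Δ(k,λ) = 0. -/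

import Mathlib

open MeasureTheory Complex Filter

/-- The Landau dispersion function
`Δ(k,λ) = 1 + (1/(ik)) ∫ φ(v)/(ikv + λ) dv`. -/
noncomputable def Landau (φ : ℝ → ℝ) (k : ℝ) (l : ℂ) : ℂ :=
  1 + (1 / (Complex.I * k)) * ∫ v : ℝ, (φ v : ℂ) / (Complex.I * k * v + l)

noncomputable def cF (φ : ℝ → ℝ) (w : ℂ) : ℂ := ∫ v : ℝ, (φ v : ℂ) / ((v : ℂ) - w)

lemma sub_ne_of_im {z : ℂ} (hz : z.im ≠ 0) (v : ℝ) : (v : ℂ) - z ≠ 0 := by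
  intro h
  apply hz
  have := congrArg Complex.im h
  simpa using this

lemma cF_integrable {φ : ℝ → ℝ} (hint : Integrable φ) {z : ℂ} (hz : z.im ≠ 0) :
    Integrable (fun v : ℝ => (φ v : ℂ) / ((v : ℂ) - z)) := by
  have h1 : Integrable (fun v : ℝ => (φ v : ℂ)) := hint.ofReal
  have hc : Continuous (fun v : ℝ => ((v : ℂ) - z)⁻¹) := by
    apply Continuous.inv₀ (by fun_prop)
    exact sub_ne_of_im hz
  simp only [div_eq_mul_inv]
  refine h1.mul_bdd (c := |z.im|⁻¹) hc.aestronglyMeasurable (Eventually.of_forall fun v => ?_)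
  rw [norm_inv]
  apply inv_anti₀ (abs_pos.2 hz)
  have := Complex.abs_im_le_norm ((v : ℂ) - z)
  simpa using this

lemma cF_conj (φ : ℝ → ℝ) (z : ℂ) : cF φ ((starRingEnd ℂ) z) = (starRingEnd ℂ) (cF φ z) := by
  unfold cF
  rw [← integral_conj]
  congr 1
  ext v
  simp

lemma cF_neg (φ : ℝ → ℝ) (z : ℂ) : cF (fun v => - φ v) z = - cF φ z := by
  unfold cF
  rw [← integral_neg]
  congr 1
  ext v
  push_cast
  ring

lemma cF_diff {φ : ℝ → ℝ} (hint : Integrable φ) {z : ℂ} (hz : 0 < z.im) :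
    DifferentiableAt ℂ (cF φ) z := by
  have key := hasDerivAt_integral_of_dominated_loc_of_deriv_le (μ := volume) (𝕜 := ℂ)
    (F := fun (w : ℂ) (v : ℝ) => (φ v : ℂ) / ((v : ℂ) - w))
    (F' := fun (w : ℂ) (v : ℝ) => (φ v : ℂ) / ((v : ℂ) - w) ^ 2)
    (x₀ := z) (s := Metric.ball z (z.im / 2)) (bound := fun v => |φ v| * ((z.im / 2) ^ 2)⁻¹)
    (Metric.ball_mem_nhds z (by positivity)) ?_ (cF_integrable hint hz.ne') ?_ ?_ ?_ ?_
  · exact key.2.differentiableAt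
  · have : ∀ᶠ w in nhds z, 0 < w.im := 
      Complex.continuous_im.continuousAt.eventually (lt_mem_nhds hz)
    filter_upwards [this] with w hw
    exact (cF_integrable hint hw.ne').aestronglyMeasurable
  · have h1 : Integrable (fun v : ℝ => (φ v : ℂ)) := hint.ofReal
    have hc : Continuous (fun v : ℝ => (((v : ℂ) - z) ^ 2)⁻¹) := by
      apply Continuous.inv₀ (by fun_prop)
      exact fun v => pow_ne_zero _ (sub_ne_of_im hz.ne' v)
    simp only [div_eq_mul_inv]
    exact h1.aestronglyMeasurable.mul hc.aestronglyMeasurable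
  · refine Eventually.of_forall fun v w hw => ?_
    rw [norm_div, Complex.norm_real, Real.norm_eq_abs, div_eq_mul_inv, norm_pow]
    gcongr
    have h2 := Complex.abs_im_le_norm (w - z)
    have h3 : ‖w - z‖ < z.im / 2 := by simpa [dist_eq_norm] using hw
    have h4 := Complex.abs_im_le_norm ((v : ℂ) - w)
    simp at h2 h4
    have h5 := abs_lt.1 (lt_of_le_of_lt h2 h3)
    have := le_abs_self w.im
    linarith
  · exact hint.abs.mul_const _
  · refine Eventually.of_forall fun v w hw => ?_
    have h2 := Complex.abs_im_le_norm (w - z)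
    have h3 : ‖w - z‖ < z.im / 2 := by simpa [dist_eq_norm] using hw
    simp at h2
    have h5 := abs_lt.1 (lt_of_le_of_lt h2 h3)
    have hw0 : w.im ≠ 0 := by linarith
    have hne := sub_ne_of_im hw0 v
    have := ((hasDerivAt_const w (φ v : ℂ)).div ((hasDerivAt_id w).const_sub (v : ℂ)) hne)
    exact this.congr_deriv (by simp)

lemma normSq_pos_of_im {z : ℂ} (hz : z.im ≠ 0) (v : ℝ) : 0 < normSq ((v : ℂ) - z) :=
  normSq_pos.2 (sub_ne_of_im hz v)

/-- partial fractions, one conjugate pair -/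
lemma real_form {φ : ℝ → ℝ} (hint : Integrable φ) {z : ℂ} (hz : 0 < z.im) {s : ℝ}
    (hs : cF φ z = s) (p : ℝ) :
    Integrable (fun v : ℝ => φ v * (v - p) / normSq ((v : ℂ) - z)) ∧
    ∫ v : ℝ, φ v * (v - p) / normSq ((v : ℂ) - z) = s := by
  set w := (starRingEnd ℂ) z with hw
  have hwim : w.im ≠ 0 := by simp [hw]; exact hz.ne'
  have hzw : z - w ≠ 0 := by
    intro h
    have := congrArg Complex.im h
    simp [hw] at this
    linarith
  have hsw : cF φ w = s := by rw [hw, cF_conj, hs, Complex.conj_ofReal]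
  have e : ∀ v : ℝ, ((φ v * (v - p) / normSq ((v : ℂ) - z) : ℝ) : ℂ) =
      (z - p) / (z - w) * ((φ v : ℂ) / ((v : ℂ) - z)) +
      (p - w) / (z - w) * ((φ v : ℂ) / ((v : ℂ) - w)) := by
    intro v
    have h1 := sub_ne_of_im hz.ne' v
    have h2 := sub_ne_of_im hwim v
    push_cast
    rw [← Complex.mul_conj, map_sub, Complex.conj_ofReal, ← hw]
    field_simp
    ring
  have i1 := (cF_integrable hint hz.ne').const_mul ((z - p) / (z - w))
  have i2 := (cF_integrable hint hwim).const_mul ((p - w) / (z - w))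
  have i3 := i1.add i2
  have hI : Integrable (fun v : ℝ => ((φ v * (v - p) / normSq ((v : ℂ) - z) : ℝ) : ℂ)) := by
    refine i3.congr (Eventually.of_forall fun v => ?_)
    exact (e v).symm
  refine ⟨by simpa only [Complex.ofReal_re, RCLike.re_to_complex] using hI.re, ?_⟩
  apply Complex.ofReal_injective
  rw [← integral_complex_ofReal]
  simp_rw [e]
  rw [integral_add i1 i2, integral_const_mul, integral_const_mul]
  change _ * cF φ z + _ * cF φ w = _
  rw [hs, hsw]
  field_simp
  ring

/-- uniqueness -/
lemma uniq {φ : ℝ → ℝ} (hint : Integrable φ) {a b c : ℝ}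
    (hsg : ∀ v, φ v * ((v - a) * (v - b) * (v - c)) ≤ 0) {s : ℝ} (hs0 : 0 < s)
    {z y : ℂ} (hz : 0 < z.im) (hy : 0 < y.im) (h1 : cF φ z = s) (h2 : cF φ y = s) : z = y := by
  by_contra hne
  set w := (starRingEnd ℂ) z with hw
  set x := (starRingEnd ℂ) y with hx
  have hwim : w.im ≠ 0 := by simp [hw]; exact hz.ne'
  have hxim : x.im ≠ 0 := by simp [hx]; exact hy.ne'
  have hwi : w.im = - z.im := by simp [hw]
  have hxi : x.im = - y.im := by simp [hx]
  have n1 : z - w ≠ 0 := by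
    intro h; have := congrArg Complex.im h; simp [hwi] at this; linarith
  have n2 : z - x ≠ 0 := by
    intro h; have := congrArg Complex.im h; simp [hxi] at this; linarith
  have n3 : y - w ≠ 0 := by
    intro h; have := congrArg Complex.im h; simp [hwi] at this; linarith
  have n4 : y - x ≠ 0 := by
    intro h; have := congrArg Complex.im h; simp [hxi] at this; linarith
  have n5 : z - y ≠ 0 := sub_ne_zero.2 hne
  have n6 : w - x ≠ 0 := by
    intro h; apply hne
    exact (starRingEnd ℂ).injective (sub_eq_zero.1 h)
  have hsw : cF φ w = s := by rw [hw, cF_conj, h1, Complex.conj_ofReal]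
  have hsx : cF φ x = s := by rw [hx, cF_conj, h2, Complex.conj_ofReal]
  obtain ⟨A, hA⟩ : ∃ A, A = (z - a) * (z - b) * (z - c) / ((z - w) * (z - y) * (z - x)) := ⟨_, rfl⟩
  obtain ⟨B, hB⟩ : ∃ B, B = (w - a) * (w - b) * (w - c) / ((z - w) * (y - w) * (w - x)) := ⟨_, rfl⟩
  obtain ⟨C, hC⟩ : ∃ C, C = - ((y - a) * (y - b) * (y - c) / ((z - y) * (y - w) * (y - x))) := ⟨_, rfl⟩
  obtain ⟨D, hD⟩ : ∃ D, D = - ((x - a) * (x - b) * (x - c) / ((z - x) * (w - x) * (y - x))) := ⟨_, rfl⟩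
  have hsum : A + B + C + D = 1 := by
    rw [hA, hB, hC, hD]
    field_simp
    ring
  have e : ∀ v : ℝ, ((φ v * ((v - a) * (v - b) * (v - c)) /
        (normSq ((v : ℂ) - z) * normSq ((v : ℂ) - y)) : ℝ) : ℂ) =
      A * ((φ v : ℂ) / ((v : ℂ) - z)) + B * ((φ v : ℂ) / ((v : ℂ) - w)) +
      C * ((φ v : ℂ) / ((v : ℂ) - y)) + D * ((φ v : ℂ) / ((v : ℂ) - x)) := by
    intro v
    have h1 := sub_ne_of_im hz.ne' v
    have h2 := sub_ne_of_im hwim v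
    have h3 := sub_ne_of_im hy.ne' v
    have h4 := sub_ne_of_im hxim v
    push_cast
    rw [← Complex.mul_conj, ← Complex.mul_conj, map_sub, map_sub, Complex.conj_ofReal, ← hw, ← hx]
    rw [hA, hB, hC, hD]
    field_simp
    ring
  have i1 := (cF_integrable hint hz.ne').const_mul A
  have i2 := (cF_integrable hint hwim).const_mul B
  have i3 := (cF_integrable hint hy.ne').const_mul C
  have i4 := (cF_integrable hint hxim).const_mul D
  have i12 : Integrable (fun v : ℝ => A * ((φ v : ℂ) / ((v : ℂ) - z)) +
      B * ((φ v : ℂ) / ((v : ℂ) - w))) := i1.add i2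
  have i123 : Integrable (fun v : ℝ => A * ((φ v : ℂ) / ((v : ℂ) - z)) +
      B * ((φ v : ℂ) / ((v : ℂ) - w)) + C * ((φ v : ℂ) / ((v : ℂ) - y))) := i12.add i3
  have hval : ∫ v : ℝ, φ v * ((v - a) * (v - b) * (v - c)) /
        (normSq ((v : ℂ) - z) * normSq ((v : ℂ) - y)) = s := by
    apply Complex.ofReal_injective
    rw [← integral_complex_ofReal]
    simp_rw [e]
    rw [integral_add i123 i4, integral_add i12 i3, integral_add i1 i2,
      integral_const_mul, integral_const_mul, integral_const_mul, integral_const_mul]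
    change _ * cF φ z + _ * cF φ w + _ * cF φ y + _ * cF φ x = _
    rw [h1, hsw, h2, hsx, ← add_mul, ← add_mul, ← add_mul, hsum, one_mul]
  have hle : ∫ v : ℝ, φ v * ((v - a) * (v - b) * (v - c)) /
        (normSq ((v : ℂ) - z) * normSq ((v : ℂ) - y)) ≤ 0 := by
    apply integral_nonpos
    intro v
    apply div_nonpos_of_nonpos_of_nonneg (hsg v)
    exact mul_nonneg (normSq_nonneg _) (normSq_nonneg _)
  linarith

/-- localisation -/
lemma local_bound {φ : ℝ → ℝ} (hint : Integrable φ) {a b c : ℝ}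
    (hsg : ∀ v, φ v * ((v - a) * (v - b) * (v - c)) ≤ 0) 
    (hic : Integrable (fun v => φ v / (v - c))) {s : ℝ}
    {z : ℂ} (hz : 0 < z.im) (h1 : cF φ z = s) :
    s * normSq (c - z) ≤ ((∫ v, φ v / (v - c)) - s) * ((c - a) * (b - c)) := by
  set w := (starRingEnd ℂ) z with hw
  have hwim : w.im ≠ 0 := by simp [hw]; exact hz.ne'
  have hwi : w.im = - z.im := by simp [hw]
  have n1 : z - w ≠ 0 := by
    intro h; have := congrArg Complex.im h; simp [hwi] at this; linarith
  have n2 := sub_ne_of_im hz.ne' c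
  have n3 := sub_ne_of_im hwim c
  have hsw : cF φ w = s := by rw [hw, cF_conj, h1, Complex.conj_ofReal]
  have hNc : (normSq ((c : ℂ) - z) : ℂ) = (c - z) * (c - w) := by
    rw [← Complex.mul_conj, map_sub, Complex.conj_ofReal]
  obtain ⟨A, hA⟩ : ∃ A, A = - ((z - a) * (z - b) / ((z - w) * (c - z))) := ⟨_, rfl⟩
  obtain ⟨B, hB⟩ : ∃ B, B = (w - a) * (w - b) / ((z - w) * (c - w)) := ⟨_, rfl⟩
  obtain ⟨C, hC⟩ : ∃ C : ℂ, C = (c - a) * (c - b) / ((c - z) * (c - w)) := ⟨_, rfl⟩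
  have hsum : A + B + C = 1 := by
    rw [hA, hB, hC]
    field_simp
    ring
  have e : ∀ v : ℝ, v ≠ c → ((φ v * ((v - a) * (v - b)) / (v - c) /
        (normSq ((v : ℂ) - z)) : ℝ) : ℂ) =
      A * ((φ v : ℂ) / ((v : ℂ) - z)) + B * ((φ v : ℂ) / ((v : ℂ) - w)) +
      C * ((φ v / (v - c) : ℝ) : ℂ) := by
    intro v hvc
    have h1 := sub_ne_of_im hz.ne' v
    have h2 := sub_ne_of_im hwim v
    have h3 : (v : ℂ) - c ≠ 0 := sub_ne_zero.2 (by exact_mod_cast hvc)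
    push_cast
    rw [← Complex.mul_conj, map_sub, Complex.conj_ofReal, ← hw]
    rw [hA, hB, hC]
    field_simp
    ring
  have i1 := (cF_integrable hint hz.ne').const_mul A
  have i2 := (cF_integrable hint hwim).const_mul B
  have i3 : Integrable (fun v => C * ((φ v / (v - c) : ℝ) : ℂ)) := hic.ofReal.const_mul C
  have hae : ∀ᵐ v : ℝ, v ≠ c := by simp [ae_iff]
  have i12 : Integrable (fun v : ℝ => A * ((φ v : ℂ) / ((v : ℂ) - z)) +
      B * ((φ v : ℂ) / ((v : ℂ) - w))) := i1.add i2
  have hval : ((∫ v : ℝ, φ v * ((v - a) * (v - b)) / (v - c) /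
        (normSq ((v : ℂ) - z)) : ℝ) : ℂ) = s + C * ((∫ v, φ v / (v - c) : ℝ) - s) := by
    rw [← integral_complex_ofReal, integral_congr_ae (hae.mono e)]
    rw [integral_add i12 i3, integral_add i1 i2,
      integral_const_mul, integral_const_mul, integral_const_mul, integral_complex_ofReal]
    change _ * cF φ z + _ * cF φ w + _ = _
    rw [h1, hsw]
    linear_combination (s : ℂ) * hsum
  have hle : ∫ v : ℝ, φ v * ((v - a) * (v - b)) / (v - c) / (normSq ((v : ℂ) - z)) ≤ 0 := by
    apply integral_nonpos
    intro v
    apply div_nonpos_of_nonpos_of_nonneg _ (normSq_nonneg _)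
    by_cases hv : v = c
    · simp [hv]
    have : φ v * ((v - a) * (v - b)) / (v - c) = φ v * ((v - a) * (v - b) * (v - c)) / (v - c) ^ 2 := by
      have := sub_ne_zero.2 hv
      field_simp
    rw [this]
    exact div_nonpos_of_nonpos_of_nonneg (hsg v) (sq_nonneg _)
  have hN := normSq_pos_of_im hz.ne' c
  have hCr : C = (((c - a) * (c - b) / normSq ((c : ℂ) - z) : ℝ) : ℂ) := by
    rw [hC, ← hNc]; push_cast; rfl
  rw [hCr] at hval
  have hval' := hval
  norm_cast at hval'
  rw [hval'] at hle
  have h5 : s * normSq (c - z) + (c - a) * (c - b) * ((∫ v, φ v / (v - c)) - s) ≤ 0 := by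
    have := mul_nonpos_of_nonpos_of_nonneg hle hN.le
    field_simp at this
    nlinarith
  nlinarith

lemma fatou_like {g : ℝ → ℝ} (hint : Integrable g) {p : ℝ}
    (hip : Integrable (fun v => g v / (v - p)))
    (hloc : ∀ᶠ v in nhds p, 0 ≤ g v * (v - p)) {t : ℝ} (ht : t < ∫ v, g v / (v - p)) :
    ∀ᶠ z : ℂ in nhds (p : ℂ), 0 < z.im → ∀ s : ℝ, cF g z = s → t < s := by
  have key : Tendsto (fun z : ℂ => ∫ v, Set.indicator {v : ℝ | 2 * ‖z - p‖ ≤ |v - p|}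
      (fun v : ℝ => g v * (v - p) / normSq ((v : ℂ) - z)) v) (nhds (p : ℂ))
      (nhds (∫ v, g v / (v - p))) := by
    apply tendsto_integral_filter_of_dominated_convergence (fun v => 4 * |g v / (v - p)|)
    · refine Eventually.of_forall fun z => ?_
      have hm : MeasurableSet {v : ℝ | 2 * ‖z - p‖ ≤ |v - p|} := by
        apply IsClosed.measurableSet
        exact isClosed_le (by fun_prop) (by fun_prop)
      refine AEStronglyMeasurable.indicator ?_ hm
      have h1 : Measurable (fun v : ℝ => (v - p) / normSq ((v : ℂ) - z)) := by
        apply Measurable.div (by fun_prop)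
        exact Complex.continuous_normSq.measurable.comp (by fun_prop)
      have := hint.aestronglyMeasurable.mul h1.aestronglyMeasurable
      refine this.congr (Eventually.of_forall fun v => ?_)
      simp [mul_div_assoc]
    · refine Eventually.of_forall fun z => Eventually.of_forall fun v => ?_
      by_cases hv : 2 * ‖z - p‖ ≤ |v - p|
      · rw [Set.indicator_of_mem (by exact hv)]
        by_cases hvp : v = p
        · simp [hvp]
        have hvp' : 0 < |v - p| := abs_pos.2 (sub_ne_zero.2 hvp)
        have h1 : |v - p| ≤ ‖(v : ℂ) - z‖ + ‖z - p‖ := by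
          have := norm_add_le ((v : ℂ) - z) (z - p)
          rw [sub_add_sub_cancel, ← Complex.ofReal_sub, Complex.norm_real, Real.norm_eq_abs] at this
          exact this
        have h2 : |v - p| / 2 ≤ ‖(v : ℂ) - z‖ := by linarith
        have h3 : |v - p| ^ 2 / 4 ≤ normSq ((v : ℂ) - z) := by
          rw [Complex.normSq_eq_norm_sq]
          nlinarith
        have h4 : 0 < normSq ((v : ℂ) - z) := lt_of_lt_of_le (by positivity) h3
        rw [Real.norm_eq_abs, abs_div, abs_mul, abs_of_pos h4, abs_div, div_le_iff₀ h4]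
        calc |g v| * |v - p| = 4 * (|g v| / |v - p|) * (|v - p| ^ 2 / 4) := by field_simp
          _ ≤ _ := by gcongr
      · rw [Set.indicator_of_notMem (by exact hv)]
        simp
    · exact hip.abs.const_mul 4
    · have hae : ∀ᵐ v : ℝ, v ≠ p := by simp [ae_iff]
      filter_upwards [hae] with v hv
      have hvp' : 0 < |v - p| := abs_pos.2 (sub_ne_zero.2 hv)
      have hne : normSq ((v : ℂ) - p) ≠ 0 := by
        rw [Ne, Complex.normSq_eq_zero, sub_eq_zero]; exact_mod_cast hv
      have hc : Tendsto (fun z : ℂ => g v * (v - p) / normSq ((v : ℂ) - z)) (nhds (p : ℂ))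
          (nhds (g v / (v - p))) := by
        have : ContinuousAt (fun z : ℂ => g v * (v - p) / normSq ((v : ℂ) - z)) (p : ℂ) := by
          have hn : ContinuousAt (fun z : ℂ => normSq ((v : ℂ) - z)) (p : ℂ) := Complex.continuous_normSq.continuousAt.comp (by fun_prop)
          exact continuousAt_const.div hn hne
        convert this.tendsto using 2
        rw [← Complex.ofReal_sub, Complex.normSq_ofReal]
        have := sub_ne_zero.2 hv
        field_simp
      refine hc.congr' ?_
      have : ∀ᶠ z : ℂ in nhds (p : ℂ), 2 * ‖z - p‖ < |v - p| := by
        have hcc : ContinuousAt (fun z : ℂ => 2 * ‖z - p‖) (p : ℂ) := by fun_prop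
        exact hcc.eventually (gt_mem_nhds (by simpa using hvp'))
      filter_upwards [this] with z hz
      rw [Set.indicator_of_mem (by exact hz.le)]
  have k1 := key.eventually (lt_mem_nhds ht)
  obtain ⟨ε, hε, hball⟩ := Metric.eventually_nhds_iff.1 hloc
  have k2 : ∀ᶠ z : ℂ in nhds (p : ℂ), 2 * ‖z - p‖ < ε := by
    have hcc : ContinuousAt (fun z : ℂ => 2 * ‖z - p‖) (p : ℂ) := by fun_prop
    exact hcc.eventually (gt_mem_nhds (by simpa using hε))
  filter_upwards [k1, k2] with z h1 h2 hz s hs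
  obtain ⟨hI, hv⟩ := real_form hint hz hs p
  refine lt_of_lt_of_le h1 ?_
  rw [← hv]
  have hm : MeasurableSet {v : ℝ | 2 * ‖z - p‖ ≤ |v - p|} := by
    apply IsClosed.measurableSet
    exact isClosed_le (by fun_prop) (by fun_prop)
  apply integral_mono (hI.indicator hm) hI
  intro v
  by_cases hv : 2 * ‖z - p‖ ≤ |v - p|
  · rw [Set.indicator_of_mem (by exact hv)]
  · rw [Set.indicator_of_notMem (by exact hv)]
    apply div_nonneg _ (normSq_nonneg _)
    apply hball
    rw [Real.dist_eq]
    push Not at hv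
    linarith

lemma cF_im {φ : ℝ → ℝ} (hint : Integrable φ) {z : ℂ} (hz : 0 < z.im) :
    Integrable (fun v : ℝ => φ v / normSq ((v : ℂ) - z)) ∧
    (cF φ z).im = z.im * ∫ v : ℝ, φ v / normSq ((v : ℂ) - z) := by
  have hI := cF_integrable hint hz.ne'
  have e : ∀ v : ℝ, ((φ v : ℂ) / ((v : ℂ) - z)).im = z.im * (φ v / normSq ((v : ℂ) - z)) := by
    intro v
    rw [Complex.div_im]
    simp
    ring
  have h1 := hI.im
  simp only [RCLike.im_to_complex, e] at h1
  constructor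
  · refine (h1.const_mul (z.im)⁻¹).congr (Eventually.of_forall fun v => ?_)
    have := hz.ne'
    simp only
    field_simp
  · have := integral_im hI
    simp only [RCLike.im_to_complex, e] at this
    rw [← integral_const_mul, this]
    rfl

lemma poisson {g : ℝ → ℝ} (hint : Integrable g) {x : ℝ} (hc : ContinuousAt g x)
    (hx : 0 < g x) : ∀ᶠ z : ℂ in nhds (x : ℂ), 0 < z.im → 0 < (cF g z).im := by
  obtain ⟨ε, hε, hball⟩ := Metric.eventually_nhds_iff.1
    (hc.eventually (lt_mem_nhds (half_lt_self hx)))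
  set m := g x / 2 with hm
  have hm0 : 0 < m := by positivity
  set d := ε / 2 with hd
  have hd0 : 0 < d := by positivity
  set N := ∫ v, |g v| with hN
  have hN0 : 0 ≤ N := integral_nonneg fun v => abs_nonneg _
  have k1 : ∀ᶠ z : ℂ in nhds (x : ℂ), ‖z - x‖ < d := by
    have hcc : ContinuousAt (fun z : ℂ => ‖z - x‖) (x : ℂ) := by fun_prop
    exact hcc.eventually (gt_mem_nhds (by simpa using hd0))
  have k2 : ∀ᶠ z : ℂ in nhds (x : ℂ), z.im * (N / d ^ 2) < m := by
    have hcc : ContinuousAt (fun z : ℂ => z.im * (N / d ^ 2)) (x : ℂ) :=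
      (Complex.continuous_im.mul continuous_const).continuousAt
    exact hcc.eventually (gt_mem_nhds (by simpa using hm0))
  filter_upwards [k1, k2] with z h1 h2 hz
  obtain ⟨hI, hv⟩ := cF_im hint hz
  rw [hv]
  apply mul_pos hz
  have him : z.im < d := by
    have := Complex.abs_im_le_norm (z - x)
    simp at this
    exact lt_of_le_of_lt (le_trans (le_abs_self _) this) h1
  have hre : |z.re - x| < d := by
    have := Complex.abs_re_le_norm (z - x)
    simp at this
    exact lt_of_le_of_lt this h1
  set T := Set.Icc (z.re - z.im) (z.re + z.im) with hT
  have hnsq : ∀ v : ℝ, normSq ((v : ℂ) - z) = (v - z.re) ^ 2 + z.im ^ 2 := by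
    intro v
    rw [Complex.normSq_apply]
    simp
    ring
  have iT : Integrable (T.indicator (fun _ : ℝ => m / (2 * z.im ^ 2))) := by
    rw [integrable_indicator_iff measurableSet_Icc]
    simp [integrableOn_const_iff]
  have iA : Integrable (fun v => |g v| / d ^ 2) := hint.abs.div_const _
  have hpt : ∀ v, T.indicator (fun _ : ℝ => m / (2 * z.im ^ 2)) v - |g v| / d ^ 2 ≤
      g v / normSq ((v : ℂ) - z) := by
    intro v
    have hnp := normSq_pos_of_im hz.ne' v
    have hab := abs_lt.1 hre
    by_cases hvx : |v - x| < ε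
    · have hgv : m < g v := hball (by rwa [Real.dist_eq])
      have : T.indicator (fun _ : ℝ => m / (2 * z.im ^ 2)) v ≤ g v / normSq ((v : ℂ) - z) := by
        by_cases hvT : v ∈ T
        · rw [Set.indicator_of_mem hvT]
          have hq : normSq ((v : ℂ) - z) ≤ 2 * z.im ^ 2 := by
            rw [hnsq]
            obtain ⟨q1, q2⟩ := hvT
            nlinarith
          have hgv0 : 0 ≤ g v := by linarith
          gcongr
        · rw [Set.indicator_of_notMem hvT]
          apply div_nonneg (by linarith) hnp.le
      have : 0 ≤ |g v| / d ^ 2 := by positivity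
      linarith
    · push Not at hvx
      have hvT : v ∉ T := by
        rintro ⟨q1, q2⟩
        have : |v - x| < ε := by rw [abs_lt]; constructor <;> linarith
        linarith
      rw [Set.indicator_of_notMem hvT]
      have hq : d ^ 2 ≤ normSq ((v : ℂ) - z) := by
        rw [hnsq]
        rcases le_abs.1 hvx with h | h <;> nlinarith [sq_nonneg z.im]
      have h6 : |g v| / normSq ((v : ℂ) - z) ≤ |g v| / d ^ 2 := by gcongr
      have h7 : - |g v| / normSq ((v : ℂ) - z) ≤ g v / normSq ((v : ℂ) - z) := by
        gcongr
        exact neg_abs_le _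
      rw [neg_div] at h7
      linarith
  have hmono := integral_mono (iT.sub iA) hI hpt
  rw [integral_sub' iT iA, integral_indicator measurableSet_Icc, setIntegral_const,
    integral_div] at hmono
  have hvol : volume.real T = 2 * z.im := by
    rw [hT, Real.volume_real_Icc_of_le (by linarith)]
    ring
  rw [hvol, smul_eq_mul, ← hN] at hmono
  refine lt_of_lt_of_le ?_ hmono
  have : 2 * z.im * (m / (2 * z.im ^ 2)) = m / z.im := by field_simp
  rw [this, sub_pos, lt_div_iff₀ hz]
  linarith

lemma lip_bound {φ : ℝ → ℝ} (hd : Differentiable ℝ φ) {C : ℝ} (hC : ∀ v, |deriv φ v| ≤ C)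
    {p : ℝ} (hp : φ p = 0) (v : ℝ) : |φ v| ≤ C * |v - p| := by
  have := Convex.norm_image_sub_le_of_norm_deriv_le (f := φ) (C := C) (s := Set.univ) (x := p)
    (y := v) (fun x _ => hd x) (fun x _ => hC x) convex_univ trivial trivial
  simpa [hp] using this

lemma quot_integrable {φ : ℝ → ℝ} (hint : Integrable φ) (hd : Differentiable ℝ φ) {C : ℝ}
    (hC : ∀ v, |deriv φ v| ≤ C) {p : ℝ} (hp : φ p = 0) :
    Integrable (fun v => φ v / (v - p)) := by
  have hC0 : 0 ≤ C := le_trans (abs_nonneg _) (hC 0)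
  have i1 : Integrable (Set.indicator (Set.Icc (p - 1) (p + 1)) (fun _ : ℝ => C)) := by
    rw [integrable_indicator_iff measurableSet_Icc]
    simp [integrableOn_const_iff]
  refine (i1.add hint.abs).mono' ?_ (Eventually.of_forall fun v => ?_)
  · exact (hd.continuous.measurable.div (by fun_prop)).aestronglyMeasurable
  · have hl := lip_bound hd hC hp v
    rw [Real.norm_eq_abs, abs_div, Pi.add_apply]
    by_cases hv : v ∈ Set.Icc (p - 1) (p + 1)
    · rw [Set.indicator_of_mem hv]
      have : |φ v| / |v - p| ≤ C := div_le_of_le_mul₀ (abs_nonneg _) hC0 hl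
      have := abs_nonneg (φ v)
      linarith
    · rw [Set.indicator_of_notMem hv, zero_add]
      apply div_le_self (abs_nonneg _)
      by_contra h
      push Not at h
      have := abs_lt.1 h
      exact hv ⟨by linarith, by linarith⟩

lemma by_parts {G φ : ℝ → ℝ} (hG : ∀ v, HasDerivAt G (φ v) v) (hint : Integrable φ)
    (hd : Differentiable ℝ φ) {C : ℝ}
    (hC : ∀ v, |deriv φ v| ≤ C) {p : ℝ} (hp : φ p = 0) (hGp : G p = 0) {B : ℝ}
    (hB : ∀ v, |G v| ≤ B) :
    Integrable (fun v => G v / (v - p) ^ 2) ∧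
    ∫ v, φ v / (v - p) = ∫ v, G v / (v - p) ^ 2 := by
  have hC0 : 0 ≤ C := le_trans (abs_nonneg _) (hC 0)
  have hB0 : 0 ≤ B := le_trans (abs_nonneg _) (hB 0)
  have hGc : Continuous G := continuous_iff_continuousAt.2 fun v => (hG v).continuousAt
  have hquad : ∀ v, |G v| ≤ C * |v - p| * |v - p| := by
    intro v
    have := Convex.norm_image_sub_le_of_norm_hasDerivWithin_le (f := G) (f' := φ)
      (C := C * |v - p|) (s := Set.uIcc p v) (x := p) (y := v)
      (fun x _ => (hG x).hasDerivWithinAt) (fun x hx => by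
        refine le_trans (lip_bound hd hC hp x) ?_
        exact mul_le_mul_of_nonneg_left (Set.abs_sub_left_of_mem_uIcc hx) hC0) (convex_uIcc _ _) Set.left_mem_uIcc Set.right_mem_uIcc
    simpa [hGp] using this
  have hi2 : Integrable (fun v => G v / (v - p) ^ 2) := by
    have i1 : Integrable (fun v : ℝ => (2 * C + 2 * B) * (1 + (v - p) ^ 2)⁻¹) :=
      (integrable_inv_one_add_sq.comp_sub_right p).const_mul _
    refine i1.mono' ?_ (Eventually.of_forall fun v => ?_)
    · exact (hGc.measurable.div (by fun_prop)).aestronglyMeasurable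
    · rw [Real.norm_eq_abs, abs_div, abs_of_nonneg (sq_nonneg (v - p))]
      by_cases hvp : v = p
      · simp [hvp]; positivity
      have hpos : 0 < (v - p) ^ 2 := by
        have := sub_ne_zero.2 hvp
        positivity
      rw [← div_eq_mul_inv, div_le_div_iff₀ hpos (by positivity)]
      have h1 := hquad v
      rw [mul_assoc, abs_mul_abs_self] at h1
      have h2 := hB v
      have h3 := abs_nonneg (G v)
      by_cases hv : (v - p) ^ 2 ≤ 1
      · nlinarith
      · push Not at hv
        nlinarith
  refine ⟨hi2, ?_⟩
  have hi1 := quot_integrable hint hd hC hp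
  have hi := hi1.sub hi2
  have hder : ∀ v, v ≠ p → HasDerivAt (fun v => G v / (v - p))
      (φ v / (v - p) - G v / (v - p) ^ 2) v := by
    intro v hv
    have hv' := sub_ne_zero.2 hv
    refine ((hG v).div ((hasDerivAt_id v).sub_const p) hv').congr_deriv ?_
    simp only [id]
    field_simp
  have hcont : ContinuousAt (fun v => G v / (v - p)) p := by
    have hb : ∀ v, |G v / (v - p)| ≤ C * |v - p| := by
      intro v
      rw [abs_div]
      exact div_le_of_le_mul₀ (abs_nonneg _) (by positivity) (hquad v)
    have : Tendsto (fun v => G v / (v - p)) (nhds p) (nhds 0) := by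
      refine squeeze_zero_norm hb ?_
      have : ContinuousAt (fun v : ℝ => C * |v - p|) p := by fun_prop
      simpa using this.tendsto
    unfold ContinuousAt
    simpa using this
  have hb : ∀ v, ‖G v / (v - p)‖ ≤ B * |(v - p)⁻¹| := by
    intro v
    rw [Real.norm_eq_abs, div_eq_mul_inv, abs_mul]
    gcongr
    exact hB v
  have htop : Tendsto (fun v => G v / (v - p)) atTop (nhds 0) := by
    refine squeeze_zero_norm hb ?_
    have : Tendsto (fun v : ℝ => (v - p)⁻¹) atTop (nhds 0) :=
      tendsto_inv_atTop_zero.comp (tendsto_atTop_add_const_right _ (-p) tendsto_id)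
    simpa using this.abs.const_mul B
  have hbot : Tendsto (fun v => G v / (v - p)) atBot (nhds 0) := by
    refine squeeze_zero_norm hb ?_
    have : Tendsto (fun v : ℝ => (v - p)⁻¹) atBot (nhds 0) :=
      tendsto_inv_atBot_zero.comp (tendsto_atBot_add_const_right _ (-p) tendsto_id)
    simpa using this.abs.const_mul B
  have e1 := integral_Ioi_of_hasDerivAt_of_tendsto hcont.continuousWithinAt
    (fun x hx => hder x (ne_of_gt hx)) hi.integrableOn htop
  have e2 := integral_Iic_of_hasDerivAt_of_tendsto hcont.continuousWithinAt
    (fun x hx => hder x (ne_of_lt hx)) hi.integrableOn hbot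
  have e3 := intervalIntegral.integral_Iic_add_Ioi (b := p) hi.integrableOn hi.integrableOn
  have e4 : ∫ v, (φ v / (v - p) - G v / (v - p) ^ 2) = 0 := by
    refine e3.symm.trans ?_
    simp only [Pi.sub_apply]
    rw [e1, e2]
    simp
  rw [integral_sub hi1 hi2] at e4
  linarith

lemma exists_root {φ : ℝ → ℝ} (hint : Integrable φ) (hcont : Continuous φ) {a b c : ℝ}
    (hac : a < c) (hcb : c < b)
    (hp1 : ∀ v : ℝ, v < a → 0 < φ v)
    (hp2 : ∀ v : ℝ, c < v → v < b → 0 < φ v)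
    (hn1 : ∀ v : ℝ, a < v → v < c → φ v < 0)
    (hn2 : ∀ v : ℝ, b < v → φ v < 0)
    (hsg : ∀ v, φ v * ((v - a) * (v - b) * (v - c)) ≤ 0)
    (ia : Integrable (fun v => φ v / (v - a)))
    (ib : Integrable (fun v => φ v / (v - b)))
    (ic : Integrable (fun v => φ v / (v - c)))
    (Fa : ∫ v, φ v / (v - a) ≤ 0) (Fb : ∫ v, φ v / (v - b) ≤ 0)
    {s₀ : ℝ} (hs₀ : 0 < s₀) (hs₁ : s₀ < ∫ v, φ v / (v - c)) :
    ∃ z : ℂ, 0 < z.im ∧ cF φ z = s₀ := by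
  set Fc := ∫ v, φ v / (v - c) with hFc
  set S : Set ℝ := {s | 0 < s ∧ ∃ z : ℂ, 0 < z.im ∧ cF φ z = s} with hS
  have hP : 0 < (c - a) * (b - c) := mul_pos (by linarith) (by linarith)
  have hlt : ∀ s ∈ S, s < Fc := by
    rintro s ⟨hs, z, hz, e⟩
    have h := local_bound hint hsg ic hz e
    have := mul_pos hs (normSq_pos_of_im hz.ne' c)
    rw [← hFc] at h
    have h2 : 0 < (Fc - s) * ((c - a) * (b - c)) := by linarith
    have := (pos_iff_pos_of_mul_pos h2).2 hP
    linarith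
  have hnint : Integrable (fun v => - φ v) := hint.neg
  have pos_ev : ∀ x : ℝ, 0 < φ x → ∀ᶠ z : ℂ in nhds (x : ℂ), 0 < z.im → 0 < (cF φ z).im :=
    fun x hx => poisson hint hcont.continuousAt hx
  have neg_ev : ∀ x : ℝ, φ x < 0 → ∀ᶠ z : ℂ in nhds (x : ℂ), 0 < z.im → (cF φ z).im < 0 := by
    intro x hx
    have := poisson hnint hcont.neg.continuousAt (x := x) (by simpa using hx)
    filter_upwards [this] with z h1 hz
    have := h1 hz
    rw [cF_neg] at this
    simpa using this
  have c_ev : ∀ t < Fc, ∀ᶠ z : ℂ in nhds (c : ℂ), 0 < z.im → ∀ s : ℝ, cF φ z = s → t < s := by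
    intro t ht
    refine fatou_like hint ic ?_ ht
    filter_upwards [Ioo_mem_nhds hac hcb] with v hv
    rcases lt_trichotomy v c with h | h | h
    · exact mul_nonneg_of_nonpos_of_nonpos (hn1 v hv.1 h).le (by linarith)
    · simp [h]
    · exact mul_nonneg (hp2 v h hv.2).le (by linarith)
  have ab_ev : ∀ p : ℝ, Integrable (fun v => φ v / (v - p)) → ∫ v, φ v / (v - p) ≤ 0 →
      (∀ᶠ v in nhds p, φ v * (v - p) ≤ 0) → ∀ t > 0, 
      ∀ᶠ z : ℂ in nhds (p : ℂ), 0 < z.im → ∀ s : ℝ, cF φ z = s → s < t := by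
    intro p ip Fp hl t ht
    have e : ∀ v, - φ v / (v - p) = - (φ v / (v - p)) := fun v => neg_div _ _
    have := fatou_like (g := fun v => - φ v) (p := p) (t := -t) hnint
      (by simp only [e]; exact ip.neg) (by
        filter_upwards [hl] with v hv
        linarith) (by
        simp only [e]
        rw [integral_neg]; linarith)
    filter_upwards [this] with z h1 hz s hs
    have := h1 hz (-s) (by rw [cF_neg, hs]; simp)
    linarith
  have a_ev := ab_ev a ia Fa (by
    filter_upwards [Iio_mem_nhds hac] with v hv
    rcases lt_trichotomy v a with h | h | h
    · exact mul_nonpos_of_nonneg_of_nonpos (hp1 v h).le (by linarith)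
    · simp [h]
    · exact mul_nonpos_of_nonpos_of_nonneg (hn1 v h hv).le (by linarith))
  have b_ev := ab_ev b ib Fb (by
    filter_upwards [Ioi_mem_nhds hcb] with v hv
    rcases lt_trichotomy v b with h | h | h
    · exact mul_nonpos_of_nonneg_of_nonpos (hp2 v hv h).le (by linarith)
    · simp [h]
    · exact mul_nonpos_of_nonpos_of_nonneg (hn2 v h).le (by linarith))
  -- nonempty
  have hne : (Set.Ioo 0 Fc ∩ S).Nonempty := by
    obtain ⟨ρ, hρ, hball⟩ := Metric.eventually_nhds_iff.1 (c_ev s₀ hs₁)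
    obtain ⟨δ, hδ0, hδ1, hδ2, hδ3⟩ : ∃ δ : ℝ, 0 < δ ∧ δ < ρ / 2 ∧ δ < c - a ∧ δ < b - c := by
      refine ⟨min (ρ / 2) (min (c - a) (b - c)) / 2, ?_, ?_, ?_, ?_⟩
      · have : 0 < min (ρ / 2) (min (c - a) (b - c)) :=
          lt_min (by positivity) (lt_min (by linarith) (by linarith))
        positivity
      · have := min_le_left (ρ / 2) (min (c - a) (b - c))
        linarith
      · have := (min_le_right (ρ / 2) (min (c - a) (b - c))).trans (min_le_left _ _)
        linarith
      · have := (min_le_right (ρ / 2) (min (c - a) (b - c))).trans (min_le_right _ _)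
        linarith
    have ht : ∀ x : ℝ, Tendsto (fun y : ℝ => (x : ℂ) + y * I) (nhdsWithin 0 (Set.Ioi 0))
        (nhds (x : ℂ)) := by
      intro x
      have : ContinuousAt (fun y : ℝ => (x : ℂ) + y * I) 0 := by fun_prop
      have h2 := this.tendsto
      simp only [Complex.ofReal_zero, zero_mul, add_zero] at h2
      exact h2.mono_left nhdsWithin_le_nhds
    have e1 := (ht (c + δ)).eventually (pos_ev (c + δ) (hp2 _ (by linarith) (by linarith)))
    have e2 := (ht (c - δ)).eventually (neg_ev (c - δ) (hn1 _ (by linarith) (by linarith)))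
    have e3 : ∀ᶠ y : ℝ in nhdsWithin 0 (Set.Ioi 0), y ∈ Set.Ioo 0 (ρ / 2) :=
      Ioo_mem_nhdsGT (by positivity)
    obtain ⟨y, ⟨h1, h2⟩, h3⟩ := ((e1.and e2).and e3).exists
    have him : ∀ x : ℝ, ((x : ℂ) + y * I).im = y := by intro x; simp
    have hc : ContinuousOn (fun x : ℝ => (cF φ ((x : ℂ) + y * I)).im) (Set.Icc (c - δ) (c + δ)) := by
      intro x _
      apply ContinuousAt.continuousWithinAt
      have hd : ContinuousAt (cF φ) ((x : ℂ) + y * I) :=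
        (cF_diff hint (by rw [him]; exact h3.1)).continuousAt
      have : ContinuousAt (fun x : ℝ => cF φ ((x : ℂ) + y * I)) x :=
        ContinuousAt.comp (f := fun x : ℝ => (x : ℂ) + y * I) hd (by fun_prop)
      exact Complex.continuous_im.continuousAt.comp this
    have := intermediate_value_Icc (by linarith) hc
    obtain ⟨x, hx, hx0⟩ := this (Set.mem_Icc.2 ⟨(h2 (by rw [him]; exact h3.1)).le,
      (h1 (by rw [him]; exact h3.1)).le⟩)
    simp only at hx0
    have hz : 0 < ((x : ℂ) + y * I).im := by rw [him]; exact h3.1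
    have hre : cF φ ((x : ℂ) + y * I) = ((cF φ ((x : ℂ) + y * I)).re : ℂ) := by
      apply Complex.ext <;> simp [hx0]
    have hdist : dist ((x : ℂ) + y * I) (c : ℂ) < ρ := by
      rw [dist_eq_norm]
      have e : (x : ℂ) + y * I - c = ((x - c : ℝ) : ℂ) + y * I := by push_cast; ring
      rw [e]
      refine lt_of_le_of_lt (norm_add_le _ _) ?_
      rw [norm_mul, Complex.norm_real, Complex.norm_real, Complex.norm_I, Real.norm_eq_abs,
        Real.norm_eq_abs, abs_of_pos h3.1]
      have : |x - c| ≤ δ := by rw [abs_le]; constructor <;> linarith [hx.1, hx.2]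
      linarith [h3.2]
    have hbig := hball hdist hz _ hre
    have hmem : (cF φ ((x : ℂ) + y * I)).re ∈ S := ⟨by linarith, _, hz, hre⟩
    exact ⟨_, ⟨hmem.1, hlt _ hmem⟩, hmem⟩
  -- open
  have hopen : IsOpen S := by
    have hU : IsOpen {z : ℂ | 0 < z.im} := isOpen_lt continuous_const Complex.continuous_im
    have han : AnalyticOnNhd ℂ (cF φ) {z : ℂ | 0 < z.im} :=
      DifferentiableOn.analyticOnNhd
        (fun z hz => (cF_diff hint hz).differentiableWithinAt) hU
    have hconv : IsPreconnected {z : ℂ | 0 < z.im} := (convex_halfSpace_im_gt 0).isPreconnected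
    rcases han.is_constant_or_isOpen hconv with ⟨w, hw⟩ | h
    · exfalso
      obtain ⟨s, _, hs, z, hz, e⟩ := hne
      have hz' : 0 < (z + I).im := by simp; linarith
      have := uniq hint hsg hs hz hz' e (by rw [hw _ hz', ← hw z hz, e])
      simp at this
    · have h1 := h _ subset_rfl hU
      have : S = Set.Ioi 0 ∩ Complex.ofReal ⁻¹' (cF φ '' {z : ℂ | 0 < z.im}) := by
        ext s
        simp [hS]
      rw [this]
      exact isOpen_Ioi.inter (h1.preimage Complex.continuous_ofReal)
  -- closed
  have hclosed : closure S ∩ Set.Ioo 0 Fc ⊆ S := by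
    rintro s ⟨hsc, hs0, hsF⟩
    obtain ⟨u, hu, hlim⟩ := mem_closure_iff_seq_limit.1 hsc
    choose hu0 z hz hzu using hu
    set K := Fc * ((c - a) * (b - c)) / (s / 2) with hK
    have hbd : ∀ᶠ n in atTop, z n ∈ Metric.closedBall (c : ℂ) (1 + K) := by
      filter_upwards [hlim.eventually (lt_mem_nhds (half_lt_self hs0))] with n hn
      have h := local_bound hint hsg ic (hz n) (hzu n)
      rw [← hFc, Complex.normSq_eq_norm_sq] at h
      rw [Metric.mem_closedBall, dist_comm, dist_eq_norm]
      have h1 : s / 2 * ‖(c : ℂ) - z n‖ ^ 2 ≤ Fc * ((c - a) * (b - c)) := by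
        have q1 : s / 2 * ‖(c : ℂ) - z n‖ ^ 2 ≤ u n * ‖(c : ℂ) - z n‖ ^ 2 := by gcongr
        have q2 : (Fc - u n) * ((c - a) * (b - c)) ≤ Fc * ((c - a) * (b - c)) := by
          have := hu0 n
          gcongr
          linarith
        linarith
      have h2 : ‖(c : ℂ) - z n‖ ^ 2 ≤ K := by
        rw [hK, le_div_iff₀ (by positivity)]
        linarith
      nlinarith [sq_nonneg (‖(c : ℂ) - z n‖ - 1), norm_nonneg ((c : ℂ) - z n)]
    obtain ⟨w, _, ψ, hψ, hw⟩ := tendsto_subseq_of_frequently_bounded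
      Metric.isBounded_closedBall hbd.frequently
    have hu' : Tendsto (u ∘ ψ) atTop (nhds s) := hlim.comp hψ.tendsto_atTop
    have hwim : 0 ≤ w.im := by
      have : Tendsto (fun n => ((z ∘ ψ) n).im) atTop (nhds w.im) :=
        (Complex.continuous_im.tendsto w).comp hw
      exact ge_of_tendsto' this fun n => (hz _).le
    rcases hwim.lt_or_eq with hpos | hzero
    · refine ⟨hs0, w, hpos, ?_⟩
      have h1 : Tendsto (fun n => cF φ ((z ∘ ψ) n)) atTop (nhds (cF φ w)) :=
        (cF_diff hint hpos).continuousAt.tendsto.comp hw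
      have h2 : Tendsto (fun n => (((u ∘ ψ) n : ℝ) : ℂ)) atTop (nhds (s : ℂ)) :=
        (Complex.continuous_ofReal.tendsto s).comp hu'
      refine tendsto_nhds_unique h1 (h2.congr fun n => ?_)
      exact (hzu _).symm
    · exfalso
      obtain ⟨x, rfl⟩ : ∃ x : ℝ, w = x := ⟨w.re, by apply Complex.ext <;> simp [hzero]⟩
      have himz : ∀ n, (cF φ (z n)).im = 0 := by intro n; rw [hzu]; simp
      have hnp : ¬ 0 < φ x := by
        intro h
        obtain ⟨n, hn⟩ := (hw.eventually (pos_ev x h)).exists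
        have := hn (hz _)
        simp [himz] at this
      have hnn : ¬ φ x < 0 := by
        intro h
        obtain ⟨n, hn⟩ := (hw.eventually (neg_ev x h)).exists
        have := hn (hz _)
        simp [himz] at this
      have hx : x = a ∨ x = b ∨ x = c := by
        by_contra hcon
        push Not at hcon
        obtain ⟨xa, xb, xc⟩ := hcon
        rcases lt_or_gt_of_ne xa with h | h
        · exact hnp (hp1 x h)
        rcases lt_or_gt_of_ne xc with h' | h'
        · exact hnn (hn1 x h h')
        rcases lt_or_gt_of_ne xb with h'' | h''
        · exact hnp (hp2 x h' h'')
        · exact hnn (hn2 x h'')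
      have hu2 := hu'.eventually (lt_mem_nhds (half_lt_self hs0))
      rcases hx with rfl | rfl | rfl
      · obtain ⟨n, hn, hn2⟩ := ((hw.eventually (a_ev (s / 2) (by positivity))).and hu2).exists
        have := hn (hz _) _ (hzu _)
        simp only [Function.comp] at hn2
        linarith
      · obtain ⟨n, hn, hn2⟩ := ((hw.eventually (b_ev (s / 2) (by positivity))).and hu2).exists
        have := hn (hz _) _ (hzu _)
        simp only [Function.comp] at hn2
        linarith
      · have hu3 := hu'.eventually (gt_mem_nhds (show s < (s + Fc) / 2 by linarith))
        obtain ⟨n, hn, hn2⟩ :=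
          ((hw.eventually (c_ev ((s + Fc) / 2) (by linarith))).and hu3).exists
        have := hn (hz _) _ (hzu _)
        simp only [Function.comp] at hn2
        linarith
  have hsub := isPreconnected_Ioo.subset_of_closure_inter_subset hopen hne hclosed
  exact (hsub ⟨hs₀, hs₁⟩).2

lemma int_piece {c u w ξ : ℝ} (huw : u ≤ w) (hc : c ∉ Set.Icc u w) :
    IntegrableOn (fun v => ξ / (v - c) ^ 2) (Set.Ioo u w) ∧
    ∫ v in Set.Ioo u w, ξ / (v - c) ^ 2 = ξ * ((u - c)⁻¹ - (w - c)⁻¹) := by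
  have hne : ∀ v ∈ Set.uIcc u w, v - c ≠ 0 := by
    intro v hv h
    rw [Set.uIcc_of_le huw] at hv
    rw [sub_eq_zero] at h
    exact hc (h ▸ hv)
  have hcon : ContinuousOn (fun v => ξ / (v - c) ^ 2) (Set.uIcc u w) := by
    apply ContinuousOn.div (by fun_prop) (by fun_prop)
    intro v hv
    exact pow_ne_zero _ (hne v hv)
  have hii := hcon.intervalIntegrable (μ := volume)
  constructor
  · exact ((intervalIntegrable_iff_integrableOn_Ioc_of_le huw).1 hii).mono_set Set.Ioo_subset_Ioc_self
  · rw [← integral_Ioc_eq_integral_Ioo, ← intervalIntegral.integral_of_le huw]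
    rw [intervalIntegral.integral_eq_sub_of_hasDerivAt (f := fun v => - (ξ * (v - c)⁻¹)) _ hii]
    · ring
    · intro v hv
      have := hne v hv
      refine ((((hasDerivAt_id v).sub_const c).inv this).const_mul ξ).neg.congr_deriv ?_
      simp only [id]
      field_simp

theorem landau_eq (φ : ℝ → ℝ) {k : ℝ} (hk : k ≠ 0) (l : ℂ) :
    Landau φ k l = 0 ↔ cF φ (I * l / k) = ((k ^ 2 : ℝ) : ℂ) := by
  have hk' : (k : ℂ) ≠ 0 := by exact_mod_cast hk
  have hI := Complex.I_ne_zero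
  have e : ∀ v : ℝ, (φ v : ℂ) / (I * k * v + l) =
      (1 / (I * k)) * ((φ v : ℂ) / ((v : ℂ) - I * l / k)) := by
    intro v
    have : I * k * v + l = (I * k) * ((v : ℂ) - I * l / k) := by
      field_simp
      linear_combination l * Complex.I_sq
    rw [this, div_mul_div_comm, one_mul]
  unfold Landau
  simp_rw [e]
  rw [integral_const_mul]
  change 1 + 1 / (I * k) * (1 / (I * k) * cF φ (I * l / k)) = 0 ↔ _
  have : 1 + 1 / (I * k) * (1 / (I * k) * cF φ (I * l / k)) = 1 - cF φ (I * l / k) / k ^ 2 := by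
    field_simp
    rw [Complex.I_sq]
    ring
  rw [this, sub_eq_zero, eq_div_iff (by positivity), one_mul]
  push_cast
  exact eq_comm


/-- Lemma 5. In the two-stream configuration, if the peak widths at
levels `ξ, η` satisfy
`(a_> - a_<)ξ/((c-a_>)(c-a_<)) + (b_> - b_<)η/((b_<-c)(b_>-c)) > k²`,
then there is exactly one unstable root `λ` of `Δ(k,·)` with `Re λ > 0`. -/
theorem two_stream_instability_peak_widths (f₀ : ℝ → ℝ) (hf : ContDiff ℝ 1 f₀)
    (htop : Tendsto f₀ atTop (nhds 0)) (hbot : Tendsto f₀ atBot (nhds 0))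
    (φ : ℝ → ℝ) (hφ : φ = deriv f₀)
    (hint : Integrable φ)
    (hφd : Differentiable ℝ φ) (hφbd : ∃ C : ℝ, ∀ v : ℝ, |deriv φ v| ≤ C)
    (a c b : ℝ) (hac : a < c) (hcb : c < b)
    (hp1 : ∀ v : ℝ, v < a → 0 < φ v)
    (hp2 : ∀ v : ℝ, c < v → v < b → 0 < φ v)
    (hn1 : ∀ v : ℝ, a < v → v < c → φ v < 0)
    (hn2 : ∀ v : ℝ, b < v → φ v < 0)
    (M : ℝ) (hMa : f₀ a = M) (hMb : f₀ b = M) (hMpos : 0 < M) (hc0 : f₀ c = 0)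
    (k : ℝ) (hk : k ≠ 0)
    (ξ η : ℝ) (hξ : ξ ∈ Set.Ioo 0 M) (hη : η ∈ Set.Ioo 0 M)
    (alt agt blt bgt : ℝ)
    (halt : alt = sSup {v : ℝ | v < a ∧ f₀ v ≤ ξ})
    (hagt : agt = sInf {v : ℝ | a < v ∧ f₀ v ≤ ξ})
    (hblt : blt = sSup {v : ℝ | v < b ∧ f₀ v ≤ η})
    (hbgt : bgt = sInf {v : ℝ | b < v ∧ f₀ v ≤ η})
    (hcond : k ^ 2 < (agt - alt) * ξ / ((c - agt) * (c - alt)) +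
        (bgt - blt) * η / ((blt - c) * (bgt - c))) :
    ∃! l : ℂ, 0 < l.re ∧ Landau φ k l = 0 := by
  subst hφ
  obtain ⟨C, hC⟩ := hφbd
  have hder : ∀ v, HasDerivAt f₀ (deriv f₀ v) v := fun v =>
    (hf.differentiable one_ne_zero v).hasDerivAt
  have hfc : Continuous f₀ := hf.continuous
  have m1 : StrictMonoOn f₀ (Set.Iic a) := strictMonoOn_of_deriv_pos (convex_Iic a)
    hfc.continuousOn (by intro x hx; rw [interior_Iic] at hx; exact hp1 x hx)
  have m2 : StrictAntiOn f₀ (Set.Icc a c) := strictAntiOn_of_deriv_neg (convex_Icc a c)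
    hfc.continuousOn (by intro x hx; rw [interior_Icc] at hx; exact hn1 x hx.1 hx.2)
  have m3 : StrictMonoOn f₀ (Set.Icc c b) := strictMonoOn_of_deriv_pos (convex_Icc c b)
    hfc.continuousOn (by intro x hx; rw [interior_Icc] at hx; exact hp2 x hx.1 hx.2)
  have m4 : StrictAntiOn f₀ (Set.Ici b) := strictAntiOn_of_deriv_neg (convex_Ici b)
    hfc.continuousOn (by intro x hx; rw [interior_Ici] at hx; exact hn2 x hx)
  have hrange : ∀ v, 0 ≤ f₀ v ∧ f₀ v ≤ M := by
    intro v
    rcases le_total v a with h1 | h1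
    · refine ⟨?_, hMa ▸ m1.monotoneOn h1 Set.self_mem_Iic h1⟩
      refine le_of_tendsto hbot ?_
      filter_upwards [Iic_mem_atBot v] with w hw
      exact m1.monotoneOn (le_trans hw h1) h1 hw
    rcases le_total v c with h2 | h2
    · refine ⟨hc0 ▸ m2.antitoneOn ⟨h1, h2⟩ (Set.right_mem_Icc.2 hac.le) h2,
        hMa ▸ m2.antitoneOn (Set.left_mem_Icc.2 hac.le) ⟨h1, h2⟩ h1⟩
    rcases le_total v b with h3 | h3
    · refine ⟨hc0 ▸ m3.monotoneOn (Set.left_mem_Icc.2 hcb.le) ⟨h2, h3⟩ h2,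
        hMb ▸ m3.monotoneOn ⟨h2, h3⟩ (Set.right_mem_Icc.2 hcb.le) h3⟩
    · refine ⟨?_, hMb ▸ m4.antitoneOn Set.self_mem_Ici h3 h3⟩
      refine le_of_tendsto htop ?_
      filter_upwards [Ici_mem_atTop v] with w hw
      exact m4.antitoneOn h3 (le_trans h3 hw) hw
  have za : deriv f₀ a = 0 := IsLocalMax.deriv_eq_zero
    (Eventually.of_forall fun v => by simp only [hMa]; exact (hrange v).2)
  have zb : deriv f₀ b = 0 := IsLocalMax.deriv_eq_zero
    (Eventually.of_forall fun v => by simp only [hMb]; exact (hrange v).2)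
  have zc : deriv f₀ c = 0 := IsLocalMin.deriv_eq_zero
    (Eventually.of_forall fun v => by simp only [hc0]; exact (hrange v).1)
  have hsg : ∀ v, deriv f₀ v * ((v - a) * (v - b) * (v - c)) ≤ 0 := by
    intro v
    rcases lt_trichotomy v a with h | h | h
    · apply mul_nonpos_of_nonneg_of_nonpos (hp1 v h).le
      apply mul_nonpos_of_nonneg_of_nonpos
      · exact mul_nonneg_of_nonpos_of_nonpos (by linarith) (by linarith)
      · linarith
    · simp [h]
    rcases lt_trichotomy v c with h' | h' | h'
    · apply mul_nonpos_of_nonpos_of_nonneg (hn1 v h h').le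
      apply mul_nonneg_of_nonpos_of_nonpos
      · exact mul_nonpos_of_nonneg_of_nonpos (by linarith) (by linarith)
      · linarith
    · simp [h']
    rcases lt_trichotomy v b with h2 | h2 | h2
    · apply mul_nonpos_of_nonneg_of_nonpos (hp2 v h' h2).le
      apply mul_nonpos_of_nonpos_of_nonneg
      · exact mul_nonpos_of_nonneg_of_nonpos (by linarith) (by linarith)
      · linarith
    · simp [h2]
    · apply mul_nonpos_of_nonpos_of_nonneg (hn2 v h2).le
      apply mul_nonneg
      · exact mul_nonneg (by linarith) (by linarith)
      · linarith
  have hmax : ∀ p, f₀ p = M → deriv f₀ p = 0 → ∫ v, deriv f₀ v / (v - p) ≤ 0 := by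
    intro p hp zp
    have := (by_parts (G := fun v => f₀ v - M) (p := p) (B := M)
      (fun v => (hder v).sub_const M) hint hφd hC zp (by simp [hp]) (by
        intro v
        rw [abs_le]
        constructor <;> linarith [(hrange v).1, (hrange v).2])).2
    rw [this]
    apply integral_nonpos
    intro v
    exact div_nonpos_of_nonpos_of_nonneg (by linarith [(hrange v).2]) (sq_nonneg _)
  have hFc : k ^ 2 < ∫ v, deriv f₀ v / (v - c) := by
    obtain ⟨hI, hv⟩ := by_parts (G := f₀) (p := c) (B := M) hder hint hφd hC zc hc0 (by
        intro v
        rw [abs_le]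
        constructor <;> linarith [(hrange v).1, (hrange v).2])
    rw [hv]
    refine lt_of_lt_of_le hcond ?_
    -- positions
    have A1 : alt ≤ a := by
      rw [halt]
      obtain ⟨v, hv1, hv2⟩ := ((hbot.eventually (gt_mem_nhds hξ.1)).and
        (Iio_mem_atBot a)).exists
      exact csSup_le ⟨v, hv2, hv1.le⟩ (fun x hx => hx.1.le)
    have A2 : ∀ v, alt < v → v < a → ξ ≤ f₀ v := by
      intro v h1 h2
      by_contra h
      push Not at h
      rw [halt] at h1
      exact absurd (le_csSup ⟨a, fun x hx => hx.1.le⟩ (⟨h2, h.le⟩ : v ∈ {v : ℝ | v < a ∧ f₀ v ≤ ξ}))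
        (not_le.2 h1)
    have A3 : a ≤ agt := by
      rw [hagt]
      exact le_csInf ⟨c, hac, by rw [hc0]; exact hξ.1.le⟩ (fun x hx => hx.1.le)
    have A4 : ∀ v, a < v → v < agt → ξ ≤ f₀ v := by
      intro v h1 h2
      by_contra h
      push Not at h
      rw [hagt] at h2
      exact absurd (csInf_le ⟨a, fun x hx => hx.1.le⟩ (⟨h1, h.le⟩ : v ∈ {v : ℝ | a < v ∧ f₀ v ≤ ξ}))
        (not_le.2 h2)
    have A5 : agt < c := by
      have e1 : ∀ᶠ v in nhdsWithin c (Set.Iio c), f₀ v < ξ :=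
        (hfc.continuousAt.eventually (gt_mem_nhds (by rw [hc0]; exact hξ.1))).filter_mono
          nhdsWithin_le_nhds
      obtain ⟨v, hv1, hv2⟩ := (e1.and (Ioo_mem_nhdsLT hac)).exists
      rw [hagt]
      exact lt_of_le_of_lt (csInf_le ⟨a, fun x hx => hx.1.le⟩ ⟨hv2.1, hv1.le⟩) hv2.2
    have B1 : b ≤ bgt := by
      rw [hbgt]
      obtain ⟨v, hv1, hv2⟩ := ((htop.eventually (gt_mem_nhds hη.1)).and
        (Ioi_mem_atTop b)).exists
      exact le_csInf ⟨v, hv2, hv1.le⟩ (fun x hx => hx.1.le)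
    have B2 : ∀ v, b < v → v < bgt → η ≤ f₀ v := by
      intro v h1 h2
      by_contra h
      push Not at h
      rw [hbgt] at h2
      exact absurd (csInf_le ⟨b, fun x hx => hx.1.le⟩ (⟨h1, h.le⟩ : v ∈ {v : ℝ | b < v ∧ f₀ v ≤ η}))
        (not_le.2 h2)
    have B3 : blt ≤ b := by
      rw [hblt]
      exact csSup_le ⟨c, hcb, by rw [hc0]; exact hη.1.le⟩ (fun x hx => hx.1.le)
    have B4 : ∀ v, blt < v → v < b → η ≤ f₀ v := by
      intro v h1 h2
      by_contra h
      push Not at h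
      rw [hblt] at h1
      exact absurd (le_csSup ⟨b, fun x hx => hx.1.le⟩ (⟨h2, h.le⟩ : v ∈ {v : ℝ | v < b ∧ f₀ v ≤ η}))
        (not_le.2 h1)
    have B5 : c < blt := by
      have e1 : ∀ᶠ v in nhdsWithin c (Set.Ioi c), f₀ v < η :=
        (hfc.continuousAt.eventually (gt_mem_nhds (by rw [hc0]; exact hη.1))).filter_mono
          nhdsWithin_le_nhds
      obtain ⟨v, hv1, hv2⟩ := (e1.and (Ioo_mem_nhdsGT hcb)).exists
      rw [hblt]
      exact lt_of_lt_of_le hv2.1 (le_csSup ⟨b, fun x hx => hx.1.le⟩ ⟨hv2.2, hv1.le⟩)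
    have A6 : ∀ v ∈ Set.Ioo alt agt, ξ ≤ f₀ v := by
      intro v hv
      rcases lt_trichotomy v a with h | h | h
      · exact A2 v hv.1 h
      · rw [h, hMa]; exact hξ.2.le
      · exact A4 v h hv.2
    have B6 : ∀ v ∈ Set.Ioo blt bgt, η ≤ f₀ v := by
      intro v hv
      rcases lt_trichotomy v b with h | h | h
      · exact B4 v hv.1 h
      · rw [h, hMb]; exact hη.2.le
      · exact B2 v h hv.2
    obtain ⟨i1, v1⟩ := int_piece (c := c) (ξ := ξ) (A1.trans A3) (fun h => by linarith [h.2])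
    obtain ⟨i2, v2⟩ := int_piece (c := c) (ξ := η) (B3.trans B1) (fun h => by linarith [h.1])
    have e1 : (agt - alt) * ξ / ((c - agt) * (c - alt)) =
        ∫ v in Set.Ioo alt agt, ξ / (v - c) ^ 2 := by
      rw [v1]
      have q1 : c - agt ≠ 0 := by linarith
      have q2 : c - alt ≠ 0 := by linarith
      have q3 : agt - c ≠ 0 := by linarith
      have q4 : alt - c ≠ 0 := by linarith
      field_simp
      ring
    have e2 : (bgt - blt) * η / ((blt - c) * (bgt - c)) =
        ∫ v in Set.Ioo blt bgt, η / (v - c) ^ 2 := by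
      rw [v2]
      have q3 : blt - c ≠ 0 := by linarith
      have q4 : bgt - c ≠ 0 := by linarith
      field_simp
      ring
    rw [e1, e2, ← integral_indicator measurableSet_Ioo, ← integral_indicator measurableSet_Ioo]
    rw [← integrable_indicator_iff measurableSet_Ioo] at i1 i2
    rw [← integral_add i1 i2]
    apply integral_mono (i1.add i2) hI
    intro v
    simp only [Pi.add_apply]
    by_cases hA : v ∈ Set.Ioo alt agt
    · have hB : v ∉ Set.Ioo blt bgt := fun h => by linarith [h.1, hA.2]
      rw [Set.indicator_of_mem hA, Set.indicator_of_notMem hB, add_zero]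
      have := A6 v hA
      gcongr
    · by_cases hB : v ∈ Set.Ioo blt bgt
      · rw [Set.indicator_of_mem hB, Set.indicator_of_notMem hA, zero_add]
        have := B6 v hB
        gcongr
      · rw [Set.indicator_of_notMem hB, Set.indicator_of_notMem hA, zero_add]
        exact div_nonneg (hrange v).1 (sq_nonneg _)
  have hk2 : 0 < k ^ 2 := by positivity
  obtain ⟨z, hz, hzr⟩ := exists_root hint hφd.continuous hac hcb hp1 hp2 hn1 hn2 hsg
    (quot_integrable hint hφd hC za) (quot_integrable hint hφd hC zb)
    (quot_integrable hint hφd hC zc) (hmax a hMa za) (hmax b hMb zb) hk2 hFc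
  have hk' : (k : ℂ) ≠ 0 := by exact_mod_cast hk
  have him : ∀ l : ℂ, (I * l / k).im = l.re / k := by
    intro l
    rw [Complex.div_ofReal_im]
    simp
  simp only [landau_eq (deriv f₀) hk]
  have hinj : ∀ l l' : ℂ, I * l / k = I * l' / k → l = l' := by
    intro l l' h
    have hI := Complex.I_ne_zero
    field_simp at h
    exact h
  have hinv : ∀ w : ℂ, I * (-I * k * w) / k = w := by
    intro w
    field_simp
    linear_combination (-w) * Complex.I_sq
  rcases lt_or_gt_of_ne hk with hneg | hpos
  · refine ⟨-I * k * (starRingEnd ℂ) z, ⟨?_, ?_⟩, ?_⟩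
    · have := him (-I * k * (starRingEnd ℂ) z)
      rw [hinv, eq_div_iff hk] at this
      rw [← this]
      simp only [Complex.conj_im]
      nlinarith
    · rw [hinv, cF_conj, hzr, Complex.conj_ofReal]
    · rintro l ⟨hl, hr⟩
      apply hinj
      rw [hinv]
      have h1 : 0 < ((starRingEnd ℂ) (I * l / k)).im := by
        rw [Complex.conj_im, him, Left.neg_pos_iff]
        exact div_neg_of_pos_of_neg hl hneg
      have := uniq hint hsg hk2 h1 hz (by rw [cF_conj, hr, Complex.conj_ofReal]) hzr
      rw [← this, Complex.conj_conj]
  · refine ⟨-I * k * z, ⟨?_, ?_⟩, ?_⟩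
    · have := him (-I * k * z)
      rw [hinv, eq_div_iff hk] at this
      rw [← this]
      positivity
    · rw [hinv, hzr]
    · rintro l ⟨hl, hr⟩
      apply hinj
      rw [hinv]
      have h1 : 0 < (I * l / k).im := by
        rw [him]
        positivity
      exact uniq hint hsg hk2 h1 hz hr hzr
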